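/- Let r ≥ 1 be a fixed integer and t_1, ..., t_r > 0 be fixed real numbers. Then for z ≥ 3, ∑ over r-tuples (k_1, ..., k_r) of integers k_i ≥ 1 with k_1 t_1 + ⋯ + k_r t_r ≤ z of the product ∏_{i=1}^r φ(k_i)/k_i equals (1/(r! (ζ(2))^r)) (∏_{i=1}^r 1/t_i) z^r + O(z^{r-1} log z). -/

import Mathlib

open Finset ArithmeticFunction Filter Topology

/-- Grouping the pairs `(d, m)` with `d * m ≤ N` by their product or by their first entry. -/
theorem sum_Ioc_sum_divisorsAntidiagonal {M : Type*} [AddCommMonoid M] (F : ℕ → ℕ → M) (N : ℕ) :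
    ∑ n ∈ Ioc 0 N, ∑ x ∈ n.divisorsAntidiagonal, F x.1 x.2 =
      ∑ d ∈ Ioc 0 N, ∑ m ∈ Ioc 0 (N / d), F d m := by
  rw [sum_sigma', sum_sigma']
  refine sum_nbij' (fun p ↦ ⟨p.2.1, p.2.2⟩) (fun p ↦ ⟨p.1 * p.2, (p.1, p.2)⟩) ?_ ?_ ?_ ?_ ?_
  · rintro ⟨n, d, m⟩ h
    simp only [mem_sigma, mem_Ioc, Nat.mem_divisorsAntidiagonal] at h ⊢
    obtain ⟨⟨h0, h1⟩, rfl, h2⟩ := h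
    have hd := Nat.pos_of_ne_zero (left_ne_zero_of_mul h2)
    have hm := Nat.pos_of_ne_zero (right_ne_zero_of_mul h2)
    refine ⟨⟨hd, (Nat.le_mul_of_pos_right d hm).trans h1⟩, hm, ?_⟩
    rw [Nat.le_div_iff_mul_le hd]
    linarith
  · rintro ⟨d, m⟩ h
    simp only [mem_sigma, mem_Ioc, Nat.mem_divisorsAntidiagonal] at h ⊢
    obtain ⟨⟨h0, h1⟩, h2, h3⟩ := h
    rw [Nat.le_div_iff_mul_le h0] at h3
    have := Nat.mul_pos h0 h2
    exact ⟨⟨this, by linarith⟩, trivial, this.ne'⟩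
  · rintro ⟨n, d, m⟩ h
    simp only [mem_sigma, mem_Ioc, Nat.mem_divisorsAntidiagonal] at h ⊢
    obtain ⟨-, rfl, -⟩ := h
    rfl
  · rintro ⟨d, m⟩ -
    rfl
  · rintro ⟨n, d, m⟩ -
    rfl

theorem totient_div_self_eq_sum_moebius {n : ℕ} (hn : 0 < n) :
    (n.totient : ℝ) / n = ∑ x ∈ n.divisorsAntidiagonal, (moebius x.1 : ℝ) / x.1 := by
  have h := (sum_eq_iff_sum_mul_moebius_eq (R := ℝ) (f := fun n ↦ (n.totient : ℝ))
    (g := fun n ↦ (n : ℝ))).1 (fun n _ ↦ mod_cast n.sum_totient) n hn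
  rw [← h, sum_div]
  refine sum_congr rfl fun x hx ↦ ?_
  obtain ⟨rfl, h0⟩ := Nat.mem_divisorsAntidiagonal.1 hx
  have h1 : (x.1 : ℝ) ≠ 0 := mod_cast left_ne_zero_of_mul h0
  have h2 : (x.2 : ℝ) ≠ 0 := mod_cast right_ne_zero_of_mul h0
  push_cast
  field_simp

theorem hasSum_moebius_div_sq :
    HasSum (fun n : ℕ ↦ (moebius n : ℝ) / (n : ℝ) ^ 2) (Real.pi ^ 2 / 6)⁻¹ := by
  have h2 : 1 < (2 : ℂ).re := by norm_num
  have hs := (LSeriesSummable_moebius_iff.2 h2).LSeriesHasSum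
  have hL : LSeries (fun n ↦ ((moebius n : ℤ) : ℂ)) 2 = (((Real.pi ^ 2 / 6)⁻¹ : ℝ) : ℂ) := by
    have := LSeries_one_mul_Lseries_moebius h2
    rw [LSeries_one_eq_riemannZeta h2, riemannZeta_two] at this
    push_cast
    exact eq_inv_of_mul_eq_one_right this
  rw [hL] at hs
  rw [← Complex.hasSum_ofReal]
  refine HasSum.congr_fun hs fun n ↦ ?_
  rcases eq_or_ne n 0 with rfl | hn
  · simp
  · rw [LSeries.term_of_ne_zero hn]
    push_cast
    norm_cast

theorem abs_sum_moebius_div_sq_sub_le (K : ℕ) :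
    |∑ d ∈ Ioc 0 K, (moebius d : ℝ) / (d : ℝ) ^ 2 - (Real.pi ^ 2 / 6)⁻¹| ≤ 2 / (K + 1) := by
  have hlim := hasSum_moebius_div_sq.tendsto_sum_nat
  rw [abs_sub_comm]
  refine le_of_tendsto ((hlim.sub_const _).abs) ?_
  filter_upwards [eventually_gt_atTop K] with n hn
  have hsplit : ∑ d ∈ range n, (moebius d : ℝ) / (d : ℝ) ^ 2 -
      ∑ d ∈ Ioc 0 K, (moebius d : ℝ) / (d : ℝ) ^ 2 =
      ∑ d ∈ Ioo K n, (moebius d : ℝ) / (d : ℝ) ^ 2 := by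
    rw [sub_eq_iff_eq_add, range_eq_Ico, ← sum_Ioo_add_eq_sum_Ico (by lia), add_comm,
      ← sum_union]
    · simp only [Nat.cast_zero, ne_eq, OfNat.ofNat_ne_zero, not_false_eq_true, zero_pow, div_zero,
        zero_add]
      congr 1
      ext; simp; lia
    · rw [disjoint_left]
      intro a; simp; lia
  rw [hsplit]
  refine (abs_sum_le_sum_abs _ _).trans (le_trans (sum_le_sum fun d _ ↦ ?_)
    (sum_Ioo_inv_sq_le (α := ℝ) K n))
  rw [abs_div, abs_of_nonneg (sq_nonneg (d : ℝ)), div_eq_mul_inv]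
  have : |(moebius d : ℝ)| ≤ 1 := mod_cast abs_moebius_le_one (n := d)
  exact mul_le_of_le_one_left (by positivity) this

theorem pow_succ_sub_pow_succ_bounds {x y : ℝ} (hy : 0 ≤ y) (hyx : y ≤ x) (r : ℕ) :
    (r + 1) * (x - y) * y ^ r ≤ x ^ (r + 1) - y ^ (r + 1) ∧
      x ^ (r + 1) - y ^ (r + 1) ≤ (r + 1) * (x - y) * x ^ r := by
  have hx := hy.trans hyx
  have hd := sub_nonneg.2 hyx
  induction r with
  | zero => simp
  | succ r ih =>
    obtain ⟨h1, h2⟩ := ih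
    have hp : y ^ (r + 1) ≤ x ^ (r + 1) := by gcongr
    constructor
    · have := mul_le_mul_of_nonneg_left h1 hy
      have := mul_nonneg hd (sub_nonneg.2 hp)
      push_cast
      linear_combination ‹y * _ ≤ _› + this
    · have := mul_le_mul_of_nonneg_left h2 hx
      have := mul_nonneg hd (sub_nonneg.2 hp)
      push_cast
      linear_combination ‹x * _ ≤ _› + this

theorem sum_sub_mul_pow_le {h z : ℝ} (hh : 0 ≤ h) (r N : ℕ) (hN : N * h ≤ z) :
    (r + 1) * h * ∑ m ∈ Ioc 0 N, (z - m * h) ^ r ≤ z ^ (r + 1) - (z - N * h) ^ (r + 1) := by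
  induction N with
  | zero => simp
  | succ N ih =>
    push_cast at hN
    rw [← insert_Ioc_right_eq_Ioc_add_one (Nat.zero_le N), sum_insert (by simp), mul_add]
    have h1 := ih (by linarith)
    have h2 := (pow_succ_sub_pow_succ_bounds (x := z - N * h) (y := z - (N + 1) * h)
      (by linarith) (by linarith) r).1
    push_cast
    linear_combination h1 + h2

theorem le_sum_sub_mul_pow {h z : ℝ} (hh : 0 ≤ h) (r N : ℕ) (hN : N * h ≤ z) :
    z ^ (r + 1) - (z - N * h) ^ (r + 1) + (r + 1) * h * (z - N * h) ^ r ≤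
      (r + 1) * h * (z ^ r + ∑ m ∈ Ioc 0 N, (z - m * h) ^ r) := by
  induction N with
  | zero => simp
  | succ N ih =>
    push_cast at hN
    rw [← insert_Ioc_right_eq_Ioc_add_one (Nat.zero_le N), sum_insert (by simp)]
    have h1 := ih (by linarith)
    have h2 := (pow_succ_sub_pow_succ_bounds (x := z - N * h) (y := z - (N + 1) * h)
      (by linarith) (by linarith) r).2
    push_cast
    linear_combination h1 + h2

/-- Riemann sum estimate for `∫ (z - x h) ^ r` over `0 ≤ x ≤ z / h`. -/
theorem abs_sum_sub_mul_pow_sub_le {h z : ℝ} (hh : 0 < h) (hz : 0 ≤ z) (r : ℕ) :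
    |∑ m ∈ Ioc 0 ⌊z / h⌋₊, (z - m * h) ^ r - z ^ (r + 1) / ((r + 1) * h)| ≤ z ^ r := by
  set N := ⌊z / h⌋₊
  have hN : N * h ≤ z := (le_div_iff₀ hh).1 (Nat.floor_le (by positivity))
  have hN' : z < (N + 1) * h := (div_lt_iff₀ hh).1 (Nat.lt_floor_add_one _)
  have hy : 0 ≤ z - N * h := sub_nonneg.2 hN
  have h1 := sum_sub_mul_pow_le hh.le r N hN
  have h2 := le_sum_sub_mul_pow hh.le r N hN
  have h3 : (z - N * h) ^ (r + 1) ≤ (r + 1) * h * (z - N * h) ^ r := by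
    rw [pow_succ']
    have : (0 : ℝ) ≤ r * h := by positivity
    gcongr
    linarith
  have h4 := pow_nonneg hy (r + 1)
  have hc : (0 : ℝ) < (r + 1) * h := by positivity
  have h5 : z ^ (r + 1) = (r + 1) * h * (z ^ (r + 1) / ((r + 1) * h)) := by field_simp
  rw [abs_le]
  constructor
  · have : z ^ (r + 1) / ((r + 1) * h) ≤ z ^ r + ∑ m ∈ Ioc 0 N, (z - m * h) ^ r := by
      rw [div_le_iff₀' hc]; linarith
    linarith
  · have : ∑ m ∈ Ioc 0 N, (z - m * h) ^ r ≤ z ^ (r + 1) / ((r + 1) * h) := by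
      rw [le_div_iff₀' hc]; linarith
    have := pow_nonneg hz r
    linarith

theorem exists_abs_sum_totient_div_mul_sub_pow_sub_le {t : ℝ} (ht : 0 < t) (r : ℕ) :
    ∃ C ≥ 0, ∀ z : ℝ, 0 ≤ z →
      |∑ k ∈ Ioc 0 ⌊z / t⌋₊, (k.totient : ℝ) / k * (z - k * t) ^ r -
          (Real.pi ^ 2 / 6)⁻¹ * z ^ (r + 1) / ((r + 1) * t)| ≤
        C * (1 + z) ^ r * (1 + Real.log (1 + z)) := by
  refine ⟨(1 + Real.log (1 + 1 / t)) + 2, ?_, fun z hz ↦ ?_⟩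
  · have := Real.log_nonneg (x := 1 + 1 / t) (by linarith [one_div_pos.2 ht])
    linarith
  set K := ⌊z / t⌋₊ with hK
  set c := (Real.pi ^ 2 / 6)⁻¹
  set B := z ^ (r + 1) / ((r + 1) * t) with hB
  have hB0 : 0 ≤ B := by positivity
  have hKz : z < (K + 1) * t := (div_lt_iff₀ ht).1 (Nat.lt_floor_add_one _)
  have hswap : ∑ k ∈ Ioc 0 K, (k.totient : ℝ) / k * (z - k * t) ^ r =
      ∑ d ∈ Ioc 0 K, (moebius d : ℝ) / d * ∑ m ∈ Ioc 0 (K / d), (z - m * (d * t)) ^ r := by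
    simp_rw [mul_sum]
    rw [← sum_Ioc_sum_divisorsAntidiagonal
      (fun d m ↦ (moebius d : ℝ) / d * (z - m * (d * t)) ^ r)]
    refine sum_congr rfl fun k hk ↦ ?_
    rw [totient_div_self_eq_sum_moebius (mem_Ioc.1 hk).1, sum_mul]
    refine sum_congr rfl fun x hx ↦ ?_
    rw [← (Nat.mem_divisorsAntidiagonal.1 hx).1]
    push_cast
    ring
  have hmain : |∑ d ∈ Ioc 0 K, (moebius d : ℝ) / d *
        ∑ m ∈ Ioc 0 (K / d), (z - m * (d * t)) ^ r -
      B * ∑ d ∈ Ioc 0 K, (moebius d : ℝ) / (d : ℝ) ^ 2| ≤ (1 + Real.log K) * z ^ r := by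
    rw [mul_sum, ← sum_sub_distrib]
    calc _ ≤ ∑ d ∈ Ioc 0 K, (d : ℝ)⁻¹ * z ^ r := by
          refine (abs_sum_le_sum_abs _ _).trans (sum_le_sum fun d hd ↦ ?_)
          have hd0 : (0 : ℝ) < d := mod_cast (mem_Ioc.1 hd).1
          have hfl : K / d = ⌊z / (d * t)⌋₊ := by
            rw [hK, ← Nat.floor_div_natCast, div_div, mul_comm t]
          have h1 := abs_sum_sub_mul_pow_sub_le (mul_pos hd0 ht) hz r
          rw [← hfl] at h1
          have h2 : |(moebius d : ℝ)| ≤ 1 := mod_cast abs_moebius_le_one (n := d)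
          have h3 : (moebius d : ℝ) / d * ∑ m ∈ Ioc 0 (K / d), (z - m * (d * t)) ^ r -
              B * ((moebius d : ℝ) / (d : ℝ) ^ 2) = (moebius d : ℝ) * ((d : ℝ)⁻¹ *
              (∑ m ∈ Ioc 0 (K / d), (z - m * (d * t)) ^ r -
                z ^ (r + 1) / ((r + 1) * (d * t)))) := by
            generalize ∑ m ∈ Ioc 0 (K / d), (z - m * (d * t)) ^ r = S
            rw [hB]
            field_simp
          rw [h3, abs_mul, abs_mul, abs_of_pos (inv_pos.2 hd0)]
          exact (mul_le_of_le_one_left (by positivity) h2).trans (by gcongr)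
      _ ≤ _ := by
          rw [← sum_mul]
          gcongr
          have := harmonic_le_one_add_log K
          rw [harmonic_eq_sum_Icc] at this
          push_cast at this
          exact this
  have htail : |B * ∑ d ∈ Ioc 0 K, (moebius d : ℝ) / (d : ℝ) ^ 2 - B * c| ≤ 2 * z ^ r := by
    rw [← mul_sub, abs_mul, abs_of_nonneg hB0]
    refine (mul_le_mul_of_nonneg_left (abs_sum_moebius_div_sq_sub_le K) hB0).trans ?_
    rw [hB, div_mul_div_comm, div_le_iff₀ (by positivity)]
    have h1 : z ≤ (r + 1) * t * (K + 1) := by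
      have : 0 ≤ r * (t * (K + 1)) := by positivity
      linarith
    have h2 := mul_le_mul_of_nonneg_left h1 (pow_nonneg hz r)
    linear_combination 2 * h2
  have hlogz : 0 ≤ Real.log (1 + z) := Real.log_nonneg (by linarith)
  have hlogt : 0 ≤ Real.log (1 + 1 / t) := Real.log_nonneg (by linarith [one_div_pos.2 ht])
  have hlogK : Real.log K ≤ Real.log (1 + z) + Real.log (1 + 1 / t) := by
    rcases Nat.eq_zero_or_pos K with h0 | h0
    · rw [h0]; simp only [Nat.cast_zero, Real.log_zero]; positivity
    · rw [← Real.log_mul (by positivity) (by positivity)]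
      refine Real.log_le_log (mod_cast h0) ((Nat.floor_le (by positivity)).trans ?_)
      rw [div_eq_mul_one_div]
      gcongr <;> linarith
  have hzr : z ^ r ≤ (1 + z) ^ r := by gcongr; linarith
  rw [hswap, mul_div_assoc, ← hB, mul_comm c]
  calc _ ≤ (1 + Real.log K) * z ^ r + 2 * z ^ r :=
        (abs_sub_le _ _ _).trans (add_le_add hmain htail)
    _ = ((1 + Real.log K) + 2) * z ^ r := by ring
    _ ≤ (((1 + Real.log (1 + 1 / t)) + 2) * (1 + Real.log (1 + z))) * (1 + z) ^ r := by
        gcongr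
        nlinarith
    _ = _ := by ring

/-- The sum of `∏ i, φ(k i) / k i` over the positive integer points of the simplex
`∑ i, k i * t i ≤ z`. -/
noncomputable def totientLatticeSum {r : ℕ} (t : Fin r → ℝ) (z : ℝ) : ℝ :=
  ∑ᶠ k ∈ {k : Fin r → ℕ | (∀ i, 1 ≤ k i) ∧ (∑ i, (k i : ℝ) * t i) ≤ z},
    ∏ i, (Nat.totient (k i) : ℝ) / (k i : ℝ)

theorem finite_setOf_sum_mul_le {r : ℕ} {t : Fin r → ℝ} (ht : ∀ i, 0 < t i) (z : ℝ) :
    {k : Fin r → ℕ | (∀ i, 1 ≤ k i) ∧ (∑ i, (k i : ℝ) * t i) ≤ z}.Finite := by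
  refine (Set.Finite.pi' fun i ↦ Set.finite_Iic ⌊z / t i⌋₊).subset fun k hk i ↦ ?_
  refine Nat.le_floor ((le_div_iff₀ (ht i)).2 (le_trans ?_ hk.2))
  exact single_le_sum (f := fun i ↦ (k i : ℝ) * t i)
    (fun j _ ↦ mul_nonneg (Nat.cast_nonneg _) (ht j).le) (mem_univ i)

theorem totientLatticeSum_zero (t : Fin 0 → ℝ) {z : ℝ} (hz : 0 ≤ z) :
    totientLatticeSum t z = 1 := by
  simp [totientLatticeSum, hz, finsum_unique]

theorem totientLatticeSum_of_neg {r : ℕ} {t : Fin r → ℝ} (ht : ∀ i, 0 < t i) {z : ℝ}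
    (hz : z < 0) : totientLatticeSum t z = 0 := by
  refine finsum_mem_eq_zero_of_forall_eq_zero fun k hk ↦ absurd hk.2 (not_le.2 (hz.trans_le ?_))
  exact sum_nonneg fun j _ ↦ mul_nonneg (Nat.cast_nonneg _) (ht j).le

theorem totientLatticeSum_succ {r : ℕ} {t : Fin (r + 1) → ℝ} (ht : ∀ i, 0 < t i) (z : ℝ) :
    totientLatticeSum t z = ∑ k ∈ Ioc 0 ⌊z / t 0⌋₊,
      (k.totient : ℝ) / k * totientLatticeSum (Fin.tail t) (z - k * t 0) := by
  unfold totientLatticeSum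
  rw [finsum_mem_def, ← finsum_comp_equiv (Fin.consEquiv fun _ ↦ ℕ), finsum_curry]
  · have hinner (k : ℕ) : ∑ᶠ k' : Fin r → ℕ, Set.indicator
        {k : Fin (r + 1) → ℕ | (∀ i, 1 ≤ k i) ∧ (∑ i, (k i : ℝ) * t i) ≤ z}
        (fun k ↦ ∏ i, (Nat.totient (k i) : ℝ) / (k i : ℝ)) (Fin.consEquiv (fun _ ↦ ℕ) (k, k')) =
        (k.totient : ℝ) / k * totientLatticeSum (Fin.tail t) (z - k * t 0) := by
      rw [totientLatticeSum, finsum_mem_def, mul_finsum]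
      refine finsum_congr fun k' ↦ ?_
      rcases Nat.eq_zero_or_pos k with rfl | hk
      · simp [Set.indicator_apply, Fin.consEquiv, Fin.forall_fin_succ]
      · have hk1 : 1 ≤ k := hk
        simp [Set.indicator_apply, Fin.consEquiv, Fin.forall_fin_succ, Fin.sum_univ_succ,
          Fin.prod_univ_succ, Fin.tail, hk1, le_sub_iff_add_le', mul_div_mul_comm]
    rw [finsum_congr hinner]
    refine finsum_eq_sum_of_support_subset _ fun k hk ↦ ?_
    rw [Function.mem_support] at hk
    rw [coe_Ioc, Set.mem_Ioc]
    refine ⟨Nat.pos_of_ne_zero fun h ↦ hk (by simp [h]), ?_⟩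
    refine Nat.le_floor ((le_div_iff₀ (ht 0)).2 ?_)
    by_contra! h
    exact hk (by rw [totientLatticeSum_of_neg (t := Fin.tail t) (fun i ↦ ht i.succ)
      (by linarith), mul_zero])
  · refine ((finite_setOf_sum_mul_le ht z).preimage
      (Fin.consEquiv fun _ ↦ ℕ).injective.injOn).subset fun p hp ↦ ?_
    exact Set.mem_of_indicator_ne_zero (a := Fin.consEquiv (fun _ ↦ ℕ) p) hp

theorem exists_abs_totientLatticeSum_sub_le {r : ℕ} {t : Fin r → ℝ} (ht : ∀ i, 0 < t i) :
    ∃ C ≥ 0, ∀ z : ℝ, 0 ≤ z →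
      |totientLatticeSum t z -
          (1 / ((r.factorial : ℝ) * (Real.pi ^ 2 / 6) ^ r)) * (∏ i, 1 / t i) * z ^ r| ≤
        C * (r * (1 + z) ^ (r - 1)) * (1 + Real.log (1 + z)) := by
  induction r with
  | zero => exact ⟨0, le_rfl, fun z hz ↦ by simp [totientLatticeSum_zero t hz]⟩
  | succ r ih =>
    obtain ⟨C₁, hC₁, h₁⟩ := ih (t := Fin.tail t) fun i ↦ ht i.succ
    obtain ⟨C₂, hC₂, h₂⟩ := exists_abs_sum_totient_div_mul_sub_pow_sub_le (ht 0) r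
    set M := (1 / ((r.factorial : ℝ) * (Real.pi ^ 2 / 6) ^ r)) * (∏ i, 1 / Fin.tail t i) with hM
    have ht0 := ht 0
    have hM0 : 0 ≤ M := mul_nonneg (by positivity)
      (prod_nonneg fun i _ ↦ (one_div_pos.2 (ht i.succ)).le)
    refine ⟨C₁ * r / t 0 + M * C₂, by positivity, fun z hz ↦ ?_⟩
    have hlog : 0 ≤ Real.log (1 + z) := Real.log_nonneg (by linarith)
    have hlead : (1 / (((r + 1).factorial : ℝ) * (Real.pi ^ 2 / 6) ^ (r + 1))) *
        (∏ i, 1 / t i) * z ^ (r + 1) =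
        M * ((Real.pi ^ 2 / 6)⁻¹ * z ^ (r + 1) / ((r + 1) * t 0)) := by
      rw [hM, Fin.prod_univ_succ, Nat.factorial_succ]
      simp only [Fin.tail]
      generalize ∏ i : Fin r, 1 / t i.succ = P
      have := Real.pi_pos
      have := r.factorial_pos
      rw [pow_succ (Real.pi ^ 2 / 6)]
      push_cast
      field_simp
    rw [hlead, totientLatticeSum_succ ht]
    have hfloor : ∀ k ∈ Ioc 0 ⌊z / t 0⌋₊, k * t 0 ≤ z := fun k hk ↦
      (le_div_iff₀ ht0).1 ((Nat.le_floor_iff (by positivity)).1 (mem_Ioc.1 hk).2)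
    have herr : |∑ k ∈ Ioc 0 ⌊z / t 0⌋₊,
          (k.totient : ℝ) / k * totientLatticeSum (Fin.tail t) (z - k * t 0) -
        M * ∑ k ∈ Ioc 0 ⌊z / t 0⌋₊, (k.totient : ℝ) / k * (z - k * t 0) ^ r| ≤
        C₁ * r / t 0 * (1 + z) ^ r * (1 + Real.log (1 + z)) := by
      rw [mul_sum, ← sum_sub_distrib]
      calc _ ≤ ∑ k ∈ Ioc 0 ⌊z / t 0⌋₊,
            C₁ * (r * (1 + z) ^ (r - 1)) * (1 + Real.log (1 + z)) := by
            refine (abs_sum_le_sum_abs _ _).trans (sum_le_sum fun k hk ↦ ?_)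
            have hkz := hfloor k hk
            have hkt : 0 ≤ k * t 0 := by positivity
            have hφ : (k.totient : ℝ) / k ≤ 1 :=
              div_le_one_of_le₀ (mod_cast Nat.totient_le k) (Nat.cast_nonneg k)
            rw [mul_left_comm, ← mul_sub, abs_mul, abs_of_nonneg (by positivity)]
            refine (mul_le_of_le_one_left (abs_nonneg _) hφ).trans
              ((h₁ _ (sub_nonneg.2 hkz)).trans ?_)
            have hl' : 0 < 1 + (z - k * t 0) := by linarith
            have hl2 : 0 ≤ Real.log (1 + (z - k * t 0)) := Real.log_nonneg (by linarith)
            gcongr <;> linarith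
        _ ≤ z / t 0 * (C₁ * (r * (1 + z) ^ (r - 1)) * (1 + Real.log (1 + z))) := by
            rw [sum_const, Nat.card_Ioc, nsmul_eq_mul]
            gcongr
            exact Nat.floor_le (by positivity)
        _ ≤ (1 + z) / t 0 * (C₁ * (r * (1 + z) ^ (r - 1)) * (1 + Real.log (1 + z))) := by
            gcongr; linarith
        _ = _ := by
            cases r with
            | zero => simp
            | succ r => rw [Nat.add_sub_cancel]; ring
    have hmain := mul_le_mul_of_nonneg_left (h₂ z hz) hM0
    rw [← abs_of_nonneg hM0, ← abs_mul, abs_of_nonneg hM0, mul_sub] at hmain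
    refine (abs_sub_le _ _ _).trans ((add_le_add herr hmain).trans ?_)
    rw [Nat.add_sub_cancel]
    have : 0 ≤ (C₁ * r / t 0 + M * C₂) * (r * (1 + z) ^ r) * (1 + Real.log (1 + z)) := by
      positivity
    push_cast
    linear_combination this

/-- **Lemma 2.** For fixed `r ≥ 1` and fixed reals `t 1, ..., t r > 0`, for `z ≥ 3`,
the sum of `∏ i, φ(k i)/(k i)` over all `r`-tuples `(k 1, ..., k r)` of positive
integers with `k 1 * t 1 + ⋯ + k r * t r ≤ z` equals
`(1/(r! ζ(2)^r)) (∏ i, 1/t i) z^r + O(z^{r-1} log z)`, where `ζ(2) = π²/6`. -/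
theorem totient_ratio_lattice_sum_asymptotic
    (r : ℕ) (hr : 1 ≤ r) (t : Fin r → ℝ) (ht : ∀ i, 0 < t i) :
    ∃ C > 0, ∀ z : ℝ, 3 ≤ z →
      |(∑ᶠ k ∈ {k : Fin r → ℕ | (∀ i, 1 ≤ k i) ∧ (∑ i, (k i : ℝ) * t i) ≤ z},
            ∏ i, (Nat.totient (k i) : ℝ) / (k i : ℝ)) -
          (1 / ((r.factorial : ℝ) * (Real.pi ^ 2 / 6) ^ r)) *
            (∏ i, 1 / t i) * z ^ r| ≤
        C * z ^ (r - 1) * Real.log z := by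
  obtain ⟨C, hC, h⟩ := exists_abs_totientLatticeSum_sub_le ht
  refine ⟨C * (r * 2 ^ (r - 1)) * 3 + 1, by positivity, fun z hz ↦ (h z (by linarith)).trans ?_⟩
  have hlog1 : 1 ≤ Real.log z := by
    rw [Real.le_log_iff_exp_le (by linarith)]
    exact (Real.exp_one_lt_three.le).trans hz
  have hlog2 : Real.log (1 + z) ≤ 2 * Real.log z := by
    have : Real.log (1 + z) ≤ Real.log (z ^ 2) := Real.log_le_log (by linarith) (by nlinarith)
    simpa [Real.log_pow] using this
  have hlog0 : 0 ≤ Real.log (1 + z) := Real.log_nonneg (by linarith)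
  calc _ ≤ C * (r * (2 * z) ^ (r - 1)) * (3 * Real.log z) := by
        gcongr <;> linarith
    _ = C * (r * 2 ^ (r - 1)) * 3 * z ^ (r - 1) * Real.log z := by rw [mul_pow]; ring
    _ ≤ _ := by gcongr; linarith
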